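/- (Dominance-based race transfer.) Let p ≤ a be positions of a trace whose events have the same thread t, such that: the actions at p and a are read or write accesses to the same memory location; if the action at a is a write then the action at p is a write; and no position k with p ≤ k < a whose event has thread t has an unlock or create action. Then for every position b, if a forms a data race with b, then p forms a data race with b. -/

import Mathlib

namespace TSan

/-- Actions an event can perform. -/
inductive Action : Type where
  | read : ℕ → Action
  | write : ℕ → Action
  | lock : ℕ → Action
  | unlock : ℕ → Action
  | create : ℕ → Action
  deriving DecidableEq

/-- An event: a thread identifier together with an action. -/
structure Event : Type where
  thread : ℕ
  act : Action

/-- Program order: earlier position, same thread. -/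
def po (tr : List Event) (i j : Fin tr.length) : Prop :=
  i < j ∧ (tr.get i).thread = (tr.get j).thread

/-- Lock order: unlock of a lock before a later lock of the same lock. -/
def lo (tr : List Event) (i j : Fin tr.length) : Prop :=
  i < j ∧ ∃ l, (tr.get i).act = Action.unlock l ∧ (tr.get j).act = Action.lock l

/-- Creation order: a create of thread t' before a later event of thread t'. -/
def cr (tr : List Event) (i j : Fin tr.length) : Prop :=
  i < j ∧ ∃ t', (tr.get i).act = Action.create t' ∧ (tr.get j).thread = t'

/-- Happens-before: reflexive-transitive closure of po ∪ lo ∪ cr. -/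
def hb (tr : List Event) : Fin tr.length → Fin tr.length → Prop :=
  Relation.ReflTransGen (fun i j => po tr i j ∨ lo tr i j ∨ cr tr i j)

/-- An action is a read or write access to memory location ℓ. -/
def isAccess (a : Action) (ℓ : ℕ) : Prop :=
  a = Action.read ℓ ∨ a = Action.write ℓ

/-- Two positions conflict: both access the same location, at least one write. -/
def conflict (tr : List Event) (i j : Fin tr.length) : Prop :=
  ∃ ℓ, isAccess (tr.get i).act ℓ ∧ isAccess (tr.get j).act ℓ ∧
    ((tr.get i).act = Action.write ℓ ∨ (tr.get j).act = Action.write ℓ)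

/-- Data race: a conflict with neither direction of happens-before. -/
def dataRace (tr : List Event) (i j : Fin tr.length) : Prop :=
  conflict tr i j ∧ ¬ hb tr i j ∧ ¬ hb tr j i

/-- Events of the same thread are ordered by happens-before along the trace. -/
theorem hb_of_le_of_thread_eq {tr : List Event} {i j : Fin tr.length} (hij : i ≤ j)
    (h : (tr.get i).thread = (tr.get j).thread) : hb tr i j := by
  rcases hij.eq_or_lt with rfl | hlt
  · exact Relation.ReflTransGen.refl
  · exact Relation.ReflTransGen.single (Or.inl ⟨hlt, h⟩)

/-- If the thread of `a` performs no unlock or create from `p` up to `a`, then everything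
reachable from an event of that thread at or after `p` is comparable to `a`. -/
theorem hb_or_hb_of_hb {tr : List Event} {p a k b : Fin tr.length}
    (hclean : ∀ k : Fin tr.length, p ≤ k → k < a → (tr.get k).thread = (tr.get a).thread →
      (¬ ∃ l, (tr.get k).act = Action.unlock l) ∧
      (¬ ∃ t', (tr.get k).act = Action.create t'))
    (hkb : hb tr k b) (hpk : p ≤ k) (hk : (tr.get k).thread = (tr.get a).thread) :
    hb tr a b ∨ hb tr b a := by
  unfold hb at hkb
  induction hkb using Relation.ReflTransGen.head_induction_on with
  | refl =>
    exact (le_total a b).imp (hb_of_le_of_thread_eq · hk.symm) (hb_of_le_of_thread_eq · hk)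
  | @head k c hkc hcb ih =>
    rcases le_or_gt a k with hak | hka
    · exact Or.inl ((hb_of_le_of_thread_eq hak hk.symm).trans (hcb.head hkc))
    · obtain ⟨hunlock, hcreate⟩ := hclean k hpk hka hk
      rcases hkc with ⟨hlt, hth⟩ | ⟨-, l, hl, -⟩ | ⟨-, t', ht', -⟩
      · exact ih (hpk.trans hlt.le) (hth.symm.trans hk)
      · exact (hunlock ⟨l, hl⟩).elim
      · exact (hcreate ⟨t', ht'⟩).elim

theorem isAccess.unique {x : Action} {m n : ℕ} (hm : isAccess x m) (hn : isAccess x n) :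
    m = n := by
  rcases hm with rfl | rfl <;> simpa [isAccess] using hn

/-- Dominance-based race transfer: a race at a dominated access `a` transfers
to the dominating access `p` when no intervening same-thread release-like
(unlock/create) action occurs. -/
theorem dominance_race_transfer (tr : List Event) (t : ℕ)
    (p a : Fin tr.length) (hpa : p ≤ a)
    (htp : (tr.get p).thread = t) (hta : (tr.get a).thread = t)
    (hacc : ∃ ℓ, isAccess (tr.get p).act ℓ ∧ isAccess (tr.get a).act ℓ ∧
      ((tr.get a).act = Action.write ℓ → (tr.get p).act = Action.write ℓ))
    (hclean : ∀ k : Fin tr.length, p ≤ k → k < a → (tr.get k).thread = t →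
      (¬ ∃ l, (tr.get k).act = Action.unlock l) ∧
      (¬ ∃ t', (tr.get k).act = Action.create t')) :
    ∀ b : Fin tr.length, dataRace tr a b → dataRace tr p b := by
  subst hta
  rintro b ⟨⟨m, ham, hbm, hw⟩, hab, hba⟩
  obtain ⟨n, hpn, han, hwn⟩ := hacc
  obtain rfl := han.unique ham
  refine ⟨⟨n, hpn, hbm, hw.imp_left hwn⟩, fun hpb => ?_, fun hbp => ?_⟩
  · exact (hb_or_hb_of_hb hclean hpb le_rfl htp).elim hab hba
  · exact hba (hbp.trans (hb_of_le_of_thread_eq hpa htp))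

end TSan
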